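/- arXiv:2507.23316 — 3 statements merged into one kernel-verified Lean document; each statement's English description precedes it below -/
import Mathlib

section
/- The exact τ-ρ region for lower semilinear copulas is { (x,y) ∈ [0,1]² : x ≤ y ≤ 1 − (1−x)^{3/2} }; that is, the set { (τ(δ), ρ(δ)) : δ ∈ 𝒟^LSL } ⊆ ℝ² equals { (x,y) ∈ [0,1]² : x ≤ y ≤ 1 − (1−x)^{3/2} }. -/
open MeasureTheory Set

/-- A lower semilinear diagonal: nondecreasing, 2-Lipschitz on `[0,1]`, `δ 1 = 1`,
`t² ≤ δ t ≤ t` on `[0,1]`, `t ↦ δ t / t` nondecreasing on `(0,1]` and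
`t ↦ δ t / t²` nonincreasing on `(0,1]`. -/
def IsLSL (δ : ℝ → ℝ) : Prop :=
  MonotoneOn δ (Icc 0 1) ∧
  LipschitzOnWith 2 δ (Icc 0 1) ∧
  δ 1 = 1 ∧
  (∀ t ∈ Icc (0:ℝ) 1, t ^ 2 ≤ δ t ∧ δ t ≤ t) ∧
  MonotoneOn (fun t => δ t / t) (Ioc 0 1) ∧
  AntitoneOn (fun t => δ t / t ^ 2) (Ioc 0 1)

/-- Kendall's tau of the lower semilinear copula with diagonal `δ`. -/
noncomputable def tauLSL (δ : ℝ → ℝ) : ℝ := 4 * (∫ t in (0:ℝ)..1, (δ t) ^ 2 / t) - 1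

/-- Spearman's rho of the lower semilinear copula with diagonal `δ`. -/
noncomputable def rhoLSL (δ : ℝ → ℝ) : ℝ := 12 * (∫ t in (0:ℝ)..1, t * δ t) - 3

/-- Spearman's footrule of the lower semilinear copula with diagonal `δ`. -/
noncomputable def phiLSL (δ : ℝ → ℝ) : ℝ := 6 * (∫ t in (0:ℝ)..1, δ t) - 2

/-- Chatterjee's rank correlation of the lower semilinear copula with diagonal `δ`,
expressed through the a.e. derivative of `δ` (represented by `deriv δ`, which agrees
with the a.e. derivative almost everywhere since `δ` is Lipschitz on `[0,1]`). -/
noncomputable def xiLSL (δ : ℝ → ℝ) : ℝ :=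
  tauLSL δ - 2 * ∫ t in (0:ℝ)..1,
    (t * deriv δ t - δ t) * (2 * δ t - t * deriv δ t) / t

/-- The diagonal `u_a`: `u_a t = t²/a` for `t ≤ a`, `u_a t = t` otherwise (`u_0 t = t`). -/
noncomputable def uDiag (a : ℝ) (t : ℝ) : ℝ :=
  if a = 0 then t else if t ≤ a then t ^ 2 / a else t

/-- The diagonal `l_a`: `l_a t = a·t` for `t ≤ a`, `l_a t = t²` otherwise. -/
noncomputable def lDiag (a : ℝ) (t : ℝ) : ℝ := if t ≤ a then a * t else t ^ 2

namespace IsLSL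

variable {δ : ℝ → ℝ}

lemma nonneg (h : IsLSL δ) {t : ℝ} (ht : t ∈ Icc (0:ℝ) 1) : 0 ≤ δ t :=
  (sq_nonneg t).trans (h.2.2.2.1 t ht).1

lemma sq_div_le (h : IsLSL δ) {t : ℝ} (ht : t ∈ Icc (0:ℝ) 1) : δ t ^ 2 / t ≤ t := by
  rcases ht.1.eq_or_lt with rfl | h0
  · simp
  · rw [div_le_iff₀ h0]
    nlinarith [h.2.2.2.1 t ht, h.nonneg ht]

lemma le_sq_div (h : IsLSL δ) {t : ℝ} (ht : t ∈ Icc (0:ℝ) 1) : t ^ 3 ≤ δ t ^ 2 / t := by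
  rcases ht.1.eq_or_lt with rfl | h0
  · simp
  · rw [le_div_iff₀ h0]
    nlinarith [h.2.2.2.1 t ht, sq_nonneg t]

lemma intervalIntegrable_mul (h : IsLSL δ) :
    IntervalIntegrable (fun t => t * δ t) volume 0 1 := by
  apply MonotoneOn.intervalIntegrable
  rw [uIcc_of_le zero_le_one]
  intro r hr s hs hrs
  exact mul_le_mul hrs (h.1 hr hs hrs) (h.nonneg hr) hs.1

lemma intervalIntegrable_sq_div (h : IsLSL δ) :
    IntervalIntegrable (fun t => δ t ^ 2 / t) volume 0 1 := by
  apply MonotoneOn.intervalIntegrable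
  rw [uIcc_of_le zero_le_one]
  intro r hr s hs hrs
  have hsnn := h.nonneg hs
  rcases hr.1.eq_or_lt with rfl | h0
  · simpa using div_nonneg (sq_nonneg (δ s)) hs.1
  · have h1 : δ r / r ≤ δ s / s := h.2.2.2.2.1 ⟨h0, hr.2⟩ ⟨h0.trans_le hrs, hs.2⟩ hrs
    have h2 := mul_le_mul (h.1 hr hs hrs) h1 (div_nonneg (h.nonneg hr) h0.le) hsnn
    calc δ r ^ 2 / r = δ r * (δ r / r) := by ring
      _ ≤ δ s * (δ s / s) := h2
      _ = δ s ^ 2 / s := by ring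

lemma tauLSL_nonneg (h : IsLSL δ) : 0 ≤ tauLSL δ := by
  have := intervalIntegral.integral_mono_on zero_le_one
    (Continuous.intervalIntegrable (u := fun t : ℝ => t ^ 3) (by fun_prop) 0 1)
    h.intervalIntegrable_sq_div (fun t ht => h.le_sq_div ht)
  rw [integral_pow] at this
  norm_num at this
  unfold tauLSL
  linarith

lemma tauLSL_le_one (h : IsLSL δ) : tauLSL δ ≤ 1 := by
  have := intervalIntegral.integral_mono_on zero_le_one h.intervalIntegrable_sq_div
    (Continuous.intervalIntegrable continuous_id 0 1) (fun t ht => h.sq_div_le ht)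
  simp only [id] at this
  rw [integral_id] at this
  norm_num at this
  unfold tauLSL
  linarith

lemma rhoLSL_le_one (h : IsLSL δ) : rhoLSL δ ≤ 1 := by
  have := intervalIntegral.integral_mono_on zero_le_one h.intervalIntegrable_mul
    (Continuous.intervalIntegrable (u := fun t : ℝ => t ^ 2) (by fun_prop) 0 1)
    (fun t ht => by nlinarith [h.2.2.2.1 t ht, ht.1])
  rw [integral_pow] at this
  norm_num at this
  unfold rhoLSL
  linarith

/-- Wherever `δ` is differentiable, `δ t / t` being nondecreasing means `δ' t ≥ δ t / t`. -/
lemma div_le_deriv (h : IsLSL δ) {t : ℝ} (ht : t ∈ Ioo (0:ℝ) 1) (hd : DifferentiableAt ℝ δ t) :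
    δ t / t ≤ deriv δ t := by
  have h1 := h.2.2.2.2.1.derivWithin_nonneg (x := t)
  have hquot : HasDerivAt (fun t => δ t / t) ((deriv δ t * t - δ t * 1) / t ^ 2) t :=
    hd.hasDerivAt.div (hasDerivAt_id t) ht.1.ne'
  rw [derivWithin_of_mem_nhds (Ioc_mem_nhds ht.1 ht.2), hquot.deriv,
    le_div_iff₀ (pow_pos ht.1 2)] at h1
  rw [div_le_iff₀ ht.1]
  linarith

lemma tauLSL_le_rhoLSL (h : IsLSL δ) : tauLSL δ ≤ rhoLSL δ := by
  have hac : AbsolutelyContinuousOnInterval δ 0 1 :=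
    LipschitzOnWith.absolutelyContinuousOnInterval
      (by rw [uIcc_of_le zero_le_one]; exact h.2.1)
  have hid : AbsolutelyContinuousOnInterval (fun t : ℝ => t) 0 1 :=
    (LipschitzWith.id.lipschitzOnWith (s := uIcc 0 1)).absolutelyContinuousOnInterval
  have hΦ : AbsolutelyContinuousOnInterval (fun t => t * t * δ t - (1/2) * (δ t * δ t)) 0 1 :=
    ((hid.fun_mul hid).fun_mul hac).sub ((hac.fun_mul hac).const_mul (1/2))
  have h0 : δ 0 = 0 := by
    have := h.2.2.2.1 0 (by simp)
    linarith [this.1, this.2]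
  have hint : IntervalIntegrable (fun t => 3 * (t * δ t) - δ t ^ 2 / t) volume 0 1 :=
    (h.intervalIntegrable_mul.const_mul 3).sub h.intervalIntegrable_sq_div
  have key : ∫ t in (0:ℝ)..1, deriv (fun t => t * t * δ t - (1/2) * (δ t * δ t)) t ≤
      ∫ t in (0:ℝ)..1, (3 * (t * δ t) - δ t ^ 2 / t) := by
    apply intervalIntegral.integral_mono_ae_restrict zero_le_one hΦ.intervalIntegrable_deriv hint
    rw [Filter.EventuallyLE, ae_restrict_iff' measurableSet_Icc]
    filter_upwards [hac.ae_differentiableAt, volume.ae_ne (0:ℝ), volume.ae_ne (1:ℝ)]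
      with t hd ht0 ht1 ht
    have hd := hd (by rwa [uIcc_of_le zero_le_one])
    have htpos : 0 < t := lt_of_le_of_ne ht.1 (Ne.symm ht0)
    have hge := h.div_le_deriv ⟨htpos, lt_of_le_of_ne ht.2 ht1⟩ hd
    have hδ := hd.hasDerivAt
    have hder := (((hasDerivAt_id' t).fun_mul (hasDerivAt_id' t)).fun_mul hδ).fun_sub
      ((hδ.fun_mul hδ).const_mul (1/2 : ℝ))
    rw [hder.deriv]
    have hprod := mul_nonneg (sub_nonneg.2 (h.2.2.2.1 t ht).1) (sub_nonneg.2 hge)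
    have hexp : (δ t - t ^ 2) * (deriv δ t - δ t / t) =
        δ t * deriv δ t - δ t ^ 2 / t - t ^ 2 * deriv δ t + t * δ t := by
      field_simp
      ring
    rw [hexp] at hprod
    linarith
  rw [hΦ.integral_deriv_eq_sub, intervalIntegral.integral_sub
    (h.intervalIntegrable_mul.const_mul 3) h.intervalIntegrable_sq_div,
    intervalIntegral.integral_const_mul, h0, h.2.2.1] at key
  unfold tauLSL rhoLSL
  linarith

/-- The supporting-line inequality between `ρ` and `τ`, obtained from a pointwise bound. -/
lemma integral_le_of_mem_Icc (h : IsLSL δ) {a : ℝ} (ha : 0 < a) (ha1 : a ≤ 1) :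
    12 * (∫ t in (0:ℝ)..1, t * δ t) - 6 * a * (∫ t in (0:ℝ)..1, δ t ^ 2 / t) ≤
      4 - 3 * a + a ^ 3 / 2 := by
  have hint : IntervalIntegrable (fun t => 12 * (t * δ t) - 6 * a * (δ t ^ 2 / t)) volume 0 1 :=
    (h.intervalIntegrable_mul.const_mul 12).sub (h.intervalIntegrable_sq_div.const_mul (6 * a))
  have hi1 : IntervalIntegrable (fun t => 12 * (t * δ t) - 6 * a * (δ t ^ 2 / t)) volume 0 a :=
    hint.mono_set (uIcc_subset_uIcc (by simp) (by simp [uIcc_of_le, ha.le, ha1]))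
  have hi2 : IntervalIntegrable (fun t => 12 * (t * δ t) - 6 * a * (δ t ^ 2 / t)) volume a 1 :=
    hint.mono_set (uIcc_subset_uIcc (by simp [uIcc_of_le, ha.le, ha1]) (by simp))
  have h1 := intervalIntegral.integral_mono_on_of_le_Ioo ha.le hi1
    (Continuous.intervalIntegrable (u := fun t : ℝ => 6 / a * t ^ 3) (by fun_prop) 0 a)
    (fun t ht => by
      have ht0 : 0 < t := ht.1
      have hnn : 0 ≤ 6 * (a * δ t - t ^ 2) ^ 2 / (a * t) := by positivity
      have : 6 * (a * δ t - t ^ 2) ^ 2 / (a * t) =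
          6 * a * (δ t ^ 2 / t) - 12 * (t * δ t) + 6 / a * t ^ 3 := by
        field_simp
        ring
      linarith)
  have h2 := intervalIntegral.integral_mono_on_of_le_Ioo ha1 hi2
    (Continuous.intervalIntegrable (u := fun t : ℝ => 12 * t ^ 2 - 6 * a * t) (by fun_prop) a 1)
    (fun t ht => by
      have ht0 : 0 < t := ha.trans ht.1
      have hb := h.2.2.2.1 t ⟨ht0.le, ht.2.le⟩
      have h3 : 0 ≤ 2 * t ^ 2 - a * (t + δ t) := by
        nlinarith [mul_le_mul_of_nonneg_left hb.2 ha.le, ht.1]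
      have hnn : 0 ≤ 6 * (t - δ t) * (2 * t ^ 2 - a * (t + δ t)) / t :=
        div_nonneg (mul_nonneg (by linarith) h3) ht0.le
      have : 6 * (t - δ t) * (2 * t ^ 2 - a * (t + δ t)) / t =
          12 * t ^ 2 - 6 * a * t - (12 * (t * δ t) - 6 * a * (δ t ^ 2 / t)) := by
        field_simp
        ring
      linarith)
  have e1 : ∫ t in (0:ℝ)..a, 6 / a * t ^ 3 = 3 / 2 * a ^ 3 := by
    rw [intervalIntegral.integral_const_mul, integral_pow]
    field_simp
    ring
  have e2 : ∫ t in a..1, (12 * t ^ 2 - 6 * a * t) = 4 * (1 - a ^ 3) - 3 * a * (1 - a ^ 2) := by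
    rw [intervalIntegral.integral_sub (Continuous.intervalIntegrable (by fun_prop) _ _)
      (Continuous.intervalIntegrable (by fun_prop) _ _), intervalIntegral.integral_const_mul,
      intervalIntegral.integral_const_mul, integral_pow, integral_id]
    norm_num
    ring
  have hsplit := intervalIntegral.integral_add_adjacent_intervals hi1 hi2
  have hlin : ∫ t in (0:ℝ)..1, (12 * (t * δ t) - 6 * a * (δ t ^ 2 / t)) =
      12 * (∫ t in (0:ℝ)..1, t * δ t) - 6 * a * (∫ t in (0:ℝ)..1, δ t ^ 2 / t) := by
    rw [intervalIntegral.integral_sub (h.intervalIntegrable_mul.const_mul 12)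
      (h.intervalIntegrable_sq_div.const_mul (6 * a)), intervalIntegral.integral_const_mul,
      intervalIntegral.integral_const_mul]
  rw [e1] at h1
  rw [e2] at h2
  linarith

lemma rhoLSL_le (h : IsLSL δ) : rhoLSL δ ≤ 1 - (1 - tauLSL δ) ^ ((3:ℝ)/2) := by
  have h0 : 0 ≤ 1 - tauLSL δ := sub_nonneg.2 h.tauLSL_le_one
  rw [Real.rpow_div_two_eq_sqrt 3 h0, show (3:ℝ) = ((3:ℕ):ℝ) by norm_num, Real.rpow_natCast]
  set a := √(1 - tauLSL δ) with ha
  have hsq : a ^ 2 = 1 - tauLSL δ := Real.sq_sqrt h0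
  have ha0 : 0 ≤ a := Real.sqrt_nonneg _
  have ha1 : a ≤ 1 := Real.sqrt_le_one.2 (by linarith [h.tauLSL_nonneg])
  rcases ha0.eq_or_lt with hpos | hpos
  · rw [← hpos]
    simpa using h.rhoLSL_le_one
  · have key := h.integral_le_of_mem_Icc hpos ha1
    have hA : ∫ t in (0:ℝ)..1, δ t ^ 2 / t = (2 - a ^ 2) / 4 := by
      rw [hsq, tauLSL]
      ring
    rw [hA] at key
    unfold rhoLSL
    linarith

end IsLSL

/-- It suffices to check the order conditions; monotonicity and the Lipschitz bound follow. -/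
lemma isLSL_of_ratio {δ : ℝ → ℝ} (h1 : δ 1 = 1)
    (hb : ∀ t ∈ Icc (0:ℝ) 1, t ^ 2 ≤ δ t ∧ δ t ≤ t)
    (hm : MonotoneOn (fun t => δ t / t) (Ioc 0 1))
    (ha : AntitoneOn (fun t => δ t / t ^ 2) (Ioc 0 1)) : IsLSL δ := by
  have h0 : δ 0 = 0 := by
    have := hb 0 (by simp)
    linarith [this.1, this.2]
  have hmono : MonotoneOn δ (Icc 0 1) := by
    intro r hr s hs hrs
    have hnn : 0 ≤ δ s := (sq_nonneg s).trans (hb s hs).1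
    rcases hr.1.eq_or_lt with rfl | hr0
    · rwa [h0]
    · have hs0 := hr0.trans_le hrs
      have := hm ⟨hr0, hr.2⟩ ⟨hs0, hs.2⟩ hrs
      calc δ r = δ r / r * r := by field_simp
        _ ≤ δ s / s * s := mul_le_mul this hrs hr0.le (div_nonneg hnn hs0.le)
        _ = δ s := by field_simp
  have hlip : ∀ r ∈ Icc (0:ℝ) 1, ∀ s ∈ Icc (0:ℝ) 1, r ≤ s → δ s - δ r ≤ 2 * (s - r) := by
    intro r hr s hs hrs
    rcases hr.1.eq_or_lt with rfl | hr0
    · linarith [(hb s hs).2, hs.1]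
    · have hs0 := hr0.trans_le hrs
      have h2 : δ s / s ^ 2 ≤ δ r / r ^ 2 := ha ⟨hr0, hr.2⟩ ⟨hs0, hs.2⟩ hrs
      have h3 : δ s / s ^ 2 * r ^ 2 ≤ δ r := (le_div_iff₀ (by positivity)).1 h2
      have h4 : δ s = δ s / s ^ 2 * s ^ 2 := by field_simp
      have h5 : δ s / s ^ 2 * s ≤ 1 := by
        have : δ s / s ^ 2 * s = δ s / s := by field_simp
        rw [this, div_le_one hs0]
        exact (hb s hs).2
      have hq : 0 ≤ δ s / s ^ 2 := div_nonneg ((sq_nonneg s).trans (hb s hs).1) (sq_nonneg s)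
      calc δ s - δ r ≤ δ s / s ^ 2 * (s + r) * (s - r) := by linarith
        _ ≤ 2 * (s - r) := by
          apply mul_le_mul_of_nonneg_right _ (sub_nonneg.2 hrs)
          nlinarith [mul_le_mul_of_nonneg_left hrs hq]
  refine ⟨hmono, ?_, h1, hb, hm, ha⟩
  apply LipschitzOnWith.of_dist_le_mul
  intro r hr s hs
  rw [Real.dist_eq, Real.dist_eq]
  norm_num
  rcases le_total r s with h | h
  · rw [abs_of_nonpos (by linarith [hmono hr hs h]), abs_of_nonpos (by linarith)]
    linarith [hlip r hr s hs h]
  · rw [abs_of_nonneg (by linarith [hmono hs hr h]), abs_of_nonneg (by linarith)]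
    linarith [hlip s hs r hr h]

/-- A two-parameter family of diagonals interpolating between `lDiag` and `uDiag`. -/
noncomputable def ulDiag (a c t : ℝ) : ℝ :=
  if t ≤ a * c then t ^ 2 / a else if t ≤ c then c * t else t ^ 2

section ulDiag

variable {a c : ℝ}

lemma isLSL_ulDiag (ha : 0 ≤ a) (ha1 : a ≤ 1) (hc : 0 ≤ c) (hc1 : c ≤ 1) :
    IsLSL (ulDiag a c) := by
  have hac : a * c ≤ c := mul_le_of_le_one_left hc ha1
  have hpos {t : ℝ} (ht : 0 < t) (h : t ≤ a * c) : 0 < a :=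
    ha.lt_of_ne (by rintro rfl; linarith)
  have hle {t : ℝ} (ht : 0 < t) (h : t ≤ a * c) : t / a ≤ c :=
    (div_le_iff₀ (hpos ht h)).2 (by linarith)
  have hdiv {t : ℝ} (ht : 0 < t) : ulDiag a c t / t =
      if t ≤ a * c then t / a else if t ≤ c then c else t := by
    unfold ulDiag
    split_ifs <;> field_simp
  have hdiv2 {t : ℝ} (ht : 0 < t) : ulDiag a c t / t ^ 2 =
      if t ≤ a * c then 1 / a else if t ≤ c then c / t else 1 := by
    unfold ulDiag
    split_ifs <;> field_simp
  apply isLSL_of_ratio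
  · unfold ulDiag
    split_ifs with h1 h2
    · have : a = 1 := by nlinarith
      simp [this]
    · linarith
    · norm_num
  · intro t ht
    rcases ht.1.eq_or_lt with rfl | h0
    · unfold ulDiag
      split_ifs <;> simp
    · have : t ≤ ulDiag a c t / t ∧ ulDiag a c t / t ≤ 1 := by
        rw [hdiv h0]
        split_ifs with h1 h2
        · exact ⟨le_div_self h0.le (hpos h0 h1) ha1, (hle h0 h1).trans hc1⟩
        · exact ⟨h2, hc1⟩
        · exact ⟨le_rfl, ht.2⟩
      rw [le_div_iff₀ h0, div_le_iff₀ h0] at this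
      constructor <;> linarith [this.1, this.2]
  · intro r hr s hs hrs
    have hr0 : 0 < r := hr.1
    simp only [hdiv hr.1, hdiv hs.1]
    split_ifs with h1 h2 h3 h4 h5 h6 <;> first
      | exact div_le_div_of_nonneg_right hrs ha
      | linarith
      | linarith [hle hr0 h1]
  · intro r hr s hs hrs
    have hr0 : 0 < r := hr.1
    simp only [hdiv2 hr.1, hdiv2 hs.1]
    split_ifs with h1 h2 h3 h4 h5 h6 <;> first
      | linarith
      | exact div_le_div_of_nonneg_left hc hr0 hrs
      | exact (one_le_div hr0).2 ‹r ≤ c›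
      | exact (one_le_div (hpos hr0 ‹r ≤ a * c›)).2 ha1
      | exact (div_le_div_iff₀ hs.1 (hpos hr0 ‹r ≤ a * c›)).2 (by linarith)

lemma integral_ulDiag_pieces (ha : 0 ≤ a) (ha1 : a ≤ 1) (hc : 0 ≤ c) (hc1 : c ≤ 1)
    {F : ℝ → ℝ → ℝ} (hF : IntervalIntegrable (fun t => F t (ulDiag a c t)) volume 0 1) :
    ∫ t in (0:ℝ)..1, F t (ulDiag a c t) = (∫ t in (0:ℝ)..(a * c), F t (t ^ 2 / a)) +
      (∫ t in (a * c)..c, F t (c * t)) + ∫ t in c..1, F t (t ^ 2) := by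
  have hac : a * c ≤ c := mul_le_of_le_one_left hc ha1
  have hac0 : 0 ≤ a * c := mul_nonneg ha hc
  have m1 : a * c ∈ uIcc (0:ℝ) 1 := by rw [uIcc_of_le zero_le_one]; exact ⟨hac0, hac.trans hc1⟩
  have m2 : c ∈ uIcc (0:ℝ) 1 := by rw [uIcc_of_le zero_le_one]; exact ⟨hc, hc1⟩
  have i1 := hF.mono_set (uIcc_subset_uIcc left_mem_uIcc m1)
  have i2 := hF.mono_set (uIcc_subset_uIcc m1 m2)
  have i3 := hF.mono_set (uIcc_subset_uIcc m2 right_mem_uIcc)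
  rw [← intervalIntegral.integral_add_adjacent_intervals (i1.trans i2) i3,
    ← intervalIntegral.integral_add_adjacent_intervals i1 i2]
  congr 1
  · congr 1
    · apply intervalIntegral.integral_congr_Ioo_of_le hac0
      intro t ht
      simp [ulDiag, ht.2.le]
    · apply intervalIntegral.integral_congr_Ioo_of_le hac
      intro t ht
      simp [ulDiag, ht.1.not_ge, ht.2.le]
  · apply intervalIntegral.integral_congr_Ioo_of_le hc1
    intro t ht
    simp [ulDiag, ht.1.not_ge, (hac.trans_lt ht.1).not_ge]

lemma tauLSL_ulDiag (ha : 0 ≤ a) (ha1 : a ≤ 1) (hc : 0 ≤ c) (hc1 : c ≤ 1) :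
    tauLSL (ulDiag a c) = c ^ 4 * (1 - a ^ 2) := by
  have e (k : ℝ) (t : ℝ) : (k * t) ^ 2 / t = k ^ 2 * t ^ 1 := by
    rcases eq_or_ne t 0 with rfl | h
    · simp
    · field_simp
  have e_div (k : ℝ) (t : ℝ) : (t ^ 2 / k) ^ 2 / t = (1 / k) ^ 2 * t ^ 3 := by
    rcases eq_or_ne t 0 with rfl | h
    · simp
    · field_simp
  have e_one (t : ℝ) : (t ^ 2) ^ 2 / t = t ^ 3 := by simpa using e_div 1 t
  rw [tauLSL, integral_ulDiag_pieces (F := fun t x => x ^ 2 / t) ha ha1 hc hc1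
    (isLSL_ulDiag ha ha1 hc hc1).intervalIntegrable_sq_div]
  simp only [e, e_div, e_one, intervalIntegral.integral_const_mul, integral_pow]
  rcases ha.eq_or_lt with rfl | h
  · norm_num
    ring
  · field_simp
    norm_num
    ring

lemma rhoLSL_ulDiag (ha : 0 ≤ a) (ha1 : a ≤ 1) (hc : 0 ≤ c) (hc1 : c ≤ 1) :
    rhoLSL (ulDiag a c) = c ^ 4 * (1 - a ^ 3) := by
  have e (k : ℝ) (t : ℝ) : t * (k * t) = k * t ^ 2 := by ring
  have e_div (k : ℝ) (t : ℝ) : t * (t ^ 2 / k) = 1 / k * t ^ 3 := by ring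
  have e_one (t : ℝ) : t * t ^ 2 = t ^ 3 := by ring
  rw [rhoLSL, integral_ulDiag_pieces (F := fun t x => t * x) ha ha1 hc hc1
    (isLSL_ulDiag ha ha1 hc hc1).intervalIntegrable_mul]
  simp only [e, e_div, e_one, intervalIntegral.integral_const_mul, integral_pow]
  rcases ha.eq_or_lt with rfl | h
  · norm_num
    ring
  · field_simp
    norm_num
    ring

end ulDiag

/-- Solvability of the equations giving the `ulDiag` diagonal with prescribed `τ` and `ρ`. -/
lemma exists_ulDiag_params {x y : ℝ} (hx : x ∈ Icc (0:ℝ) 1) (hxy : x ≤ y)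
    (hy : y ≤ 1 - (1 - x) ^ ((3:ℝ)/2)) :
    ∃ a ∈ Icc (0:ℝ) 1, ∃ c ∈ Icc (0:ℝ) 1, c ^ 4 * (1 - a ^ 2) = x ∧ c ^ 4 * (1 - a ^ 3) = y := by
  have h0 : 0 ≤ 1 - x := sub_nonneg.2 hx.2
  rw [Real.rpow_div_two_eq_sqrt 3 h0, show (3:ℝ) = ((3:ℕ):ℝ) by norm_num, Real.rpow_natCast] at hy
  set s := √(1 - x)
  have hsq : s ^ 2 = 1 - x := Real.sq_sqrt h0
  have hs0 : 0 ≤ s := Real.sqrt_nonneg _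
  have hs1 : s ≤ 1 := Real.sqrt_le_one.2 (by linarith [hx.1])
  rcases hx.1.eq_or_lt with rfl | hx0
  · have : s = 1 := by nlinarith
    rw [this] at hy
    exact ⟨0, by simp, 0, by simp, by simp, by norm_num at hy ⊢; linarith⟩
  · obtain ⟨a, ha, hfa⟩ := intermediate_value_Icc hs0
      (f := fun a => x * (1 - a ^ 3) - y * (1 - a ^ 2)) (by fun_prop)
      (show (0:ℝ) ∈ _ from ⟨by norm_num; linarith, by
        simp only [hsq]
        nlinarith⟩)
    have ha2 : a ^ 2 ≤ 1 - x := hsq ▸ pow_le_pow_left₀ ha.1 ha.2 2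
    have hd : 0 < 1 - a ^ 2 := by linarith
    have hq : 0 ≤ x / (1 - a ^ 2) := by positivity
    refine ⟨a, ⟨ha.1, ha.2.trans hs1⟩, √√(x / (1 - a ^ 2)), ⟨Real.sqrt_nonneg _, ?_⟩, ?_⟩
    · rw [Real.sqrt_le_one, Real.sqrt_le_one, div_le_one hd]
      linarith
    · have h4 : √√(x / (1 - a ^ 2)) ^ 4 = x / (1 - a ^ 2) := by
        rw [show 4 = 2 * 2 from rfl, pow_mul, Real.sq_sqrt (Real.sqrt_nonneg _), Real.sq_sqrt hq]
      rw [h4]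
      refine ⟨by field_simp, ?_⟩
      simp only at hfa
      field_simp
      linarith

/-- The exact τ-ρ region for lower semilinear copulas equals
`{(x,y) ∈ [0,1]² : x ≤ y ≤ 1 − (1−x)^{3/2}}`. -/
theorem tau_rho_region :
    {p : ℝ × ℝ | ∃ δ : ℝ → ℝ, IsLSL δ ∧ p = (tauLSL δ, rhoLSL δ)} =
    {p : ℝ × ℝ | p.1 ∈ Icc (0:ℝ) 1 ∧ p.2 ∈ Icc (0:ℝ) 1 ∧
      p.1 ≤ p.2 ∧ p.2 ≤ 1 - (1 - p.1) ^ ((3:ℝ)/2)} := by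
  ext ⟨x, y⟩
  constructor
  · rintro ⟨δ, h, hp⟩
    rw [hp]
    exact ⟨⟨h.tauLSL_nonneg, h.tauLSL_le_one⟩,
      ⟨h.tauLSL_nonneg.trans h.tauLSL_le_rhoLSL, h.rhoLSL_le_one⟩, h.tauLSL_le_rhoLSL, h.rhoLSL_le⟩
  · rintro ⟨hx, -, hxy, hy⟩
    obtain ⟨a, ⟨ha, ha1⟩, c, ⟨hc, hc1⟩, h1, h2⟩ := exists_ulDiag_params hx hxy hy
    refine ⟨ulDiag a c, isLSL_ulDiag ha ha1 hc hc1, ?_⟩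
    rw [tauLSL_ulDiag ha ha1 hc hc1, rhoLSL_ulDiag ha ha1 hc hc1, h1, h2]
end

section
/- For every lower semilinear diagonal δ ∈ 𝒟^LSL, (φ(δ))^{4/3} ≤ ρ(δ); equivalently, (φ(δ))⁴ ≤ (ρ(δ))³. -/
open MeasureTheory Set

/-- A lower semilinear diagonal is single-crossing relative to `t ↦ t * max a t`. -/
lemma IsLSL.exists_crossing {δ : ℝ → ℝ} (hδ : IsLSL δ) (a : ℝ) :
    ∃ c : ℝ, ∀ t ∈ Icc (0:ℝ) 1, 0 ≤ (t - c) * (δ t - t * max a t) := by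
  obtain ⟨-, -, -, hb, hmono, -⟩ := hδ
  set S : Set ℝ := insert 0 {t | t ∈ Ioc (0:ℝ) 1 ∧ δ t < a * t}
  have hS : BddAbove S := ⟨1, by
    rintro x (rfl | hx)
    · exact zero_le_one
    · exact hx.1.2⟩
  refine ⟨sSup S, fun t ht => ?_⟩
  rcases ht.1.eq_or_lt with rfl | ht0
  · have h0 : δ 0 = 0 := by
      have := hb 0 ht
      exact le_antisymm this.2 (by simpa using this.1)
    simp [h0]
  rcases lt_or_ge (sSup S) t with hct | htc
  · have hnot : t ∉ S := notMem_of_csSup_lt hct hS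
    have h1 : a * t ≤ δ t := by
      by_contra! h
      exact hnot (Or.inr ⟨⟨ht0, ht.2⟩, h⟩)
    have h2 := (hb t ht).1
    refine mul_nonneg (sub_nonneg.2 hct.le) (sub_nonneg.2 ?_)
    rcases max_choice a t with h | h <;> rw [h] <;> nlinarith
  rcases htc.eq_or_lt with rfl | htc
  · simp
  · obtain ⟨s, hs, hts⟩ := exists_lt_of_lt_csSup (insert_nonempty _ _) htc
    rcases hs with rfl | ⟨hs, hsa⟩
    · exact absurd hts ht0.not_gt
    have h1 : δ t / t ≤ δ s / s := hmono ⟨ht0, ht.2⟩ hs hts.le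
    have h2 : δ s / s < a := (div_lt_iff₀ hs.1).2 hsa
    have h3 : δ t < a * t := (div_lt_iff₀ ht0).1 (h1.trans_lt h2)
    have h4 := le_max_left a t
    refine mul_nonneg_of_nonpos_of_nonpos (sub_nonpos.2 htc.le) (sub_nonpos.2 ?_)
    nlinarith

lemma integral_pow_mul_max {a : ℝ} (ha : a ∈ Icc (0:ℝ) 1) (n : ℕ) :
    ∫ t in (0:ℝ)..1, t ^ n * max a t =
      a * (a ^ (n + 1) / (n + 1)) + (1 - a ^ (n + 2)) / (n + 2) := by
  have hi : ∀ x y : ℝ, IntervalIntegrable (fun t : ℝ => t ^ n * max a t) volume x y :=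
    fun x y => Continuous.intervalIntegrable (by fun_prop) x y
  rw [← intervalIntegral.integral_add_adjacent_intervals (hi 0 a) (hi a 1)]
  congr 1
  · rw [intervalIntegral.integral_congr (g := fun t => a * t ^ n)]
    · rw [intervalIntegral.integral_const_mul, integral_pow]
      simp
    · intro t ht
      rw [uIcc_of_le ha.1] at ht
      simp only [max_eq_left ht.2]
      ring
  · rw [intervalIntegral.integral_congr (g := fun t => t ^ (n + 1))]
    · rw [integral_pow]
      push_cast
      rw [one_pow]
      ring
    · intro t ht
      rw [uIcc_of_le ha.2] at ht
      simp only [max_eq_right ht.1]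
      ring

lemma IsLSL.intervalIntegrable {δ : ℝ → ℝ} (hδ : IsLSL δ) :
    IntervalIntegrable δ volume 0 1 :=
  ContinuousOn.intervalIntegrable (by
    rw [uIcc_of_le zero_le_one]
    exact hδ.2.1.continuousOn)

lemma IsLSL.phiLSL_mem_Icc {δ : ℝ → ℝ} (hδ : IsLSL δ) : phiLSL δ ∈ Icc (0:ℝ) 1 := by
  have hb := hδ.2.2.2.1
  have h1 : ∫ t in (0:ℝ)..1, t ^ 2 ≤ ∫ t in (0:ℝ)..1, δ t :=
    intervalIntegral.integral_mono_on zero_le_one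
      (Continuous.intervalIntegrable (by fun_prop) _ _) hδ.intervalIntegrable
      fun t ht => (hb t ht).1
  have h2 : ∫ t in (0:ℝ)..1, δ t ≤ ∫ t in (0:ℝ)..1, t :=
    intervalIntegral.integral_mono_on zero_le_one hδ.intervalIntegrable
      (Continuous.intervalIntegrable (by fun_prop) _ _) fun t ht => (hb t ht).2
  rw [integral_pow] at h1
  rw [integral_id] at h2
  norm_num at h1 h2
  constructor <;> rw [phiLSL] <;> linarith

/-- If the footrule of `δ` is `a ^ 3`, i.e. the footrule of `lDiag a`, then its Spearman's rho
is at least `a ^ 4`, the Spearman's rho of `lDiag a`. -/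
lemma IsLSL.pow_four_le_rhoLSL {δ : ℝ → ℝ} (hδ : IsLSL δ) {a : ℝ} (ha : a ∈ Icc (0:ℝ) 1)
    (hφ : phiLSL δ = a ^ 3) : a ^ 4 ≤ rhoLSL δ := by
  obtain ⟨c, hc⟩ := hδ.exists_crossing a
  have hi := hδ.intervalIntegrable
  have hi' : IntervalIntegrable (fun t => t * δ t) volume 0 1 :=
    hi.continuousOn_mul continuousOn_id
  have hm : ∀ n : ℕ, IntervalIntegrable (fun t : ℝ => t ^ n * max a t) volume 0 1 :=
    fun n => Continuous.intervalIntegrable (by fun_prop) _ _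
  have key : 0 ≤ ∫ t in (0:ℝ)..1,
      ((t * δ t - c * δ t) - (t ^ 2 * max a t - c * (t ^ 1 * max a t))) := by
    refine intervalIntegral.integral_nonneg zero_le_one fun t ht => ?_
    convert hc t ht using 1
    ring
  rw [intervalIntegral.integral_sub (hi'.sub (hi.const_mul c))
      ((hm 2).sub ((hm 1).const_mul c)),
    intervalIntegral.integral_sub hi' (hi.const_mul c),
    intervalIntegral.integral_sub (hm 2) ((hm 1).const_mul c),
    intervalIntegral.integral_const_mul, intervalIntegral.integral_const_mul,
    integral_pow_mul_max ha, integral_pow_mul_max ha] at key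
  have hI : ∫ t in (0:ℝ)..1, δ t = 1 / 3 + a ^ 3 / 6 := by
    rw [phiLSL] at hφ
    linarith
  rw [hI] at key
  norm_num at key
  rw [rhoLSL]
  linarith

/-- For every lower semilinear diagonal, `(φ(δ))^{4/3} ≤ ρ(δ)`;
equivalently, `(φ(δ))⁴ ≤ (ρ(δ))³`. -/
theorem phi_rpow_le_rho (δ : ℝ → ℝ) (hδ : IsLSL δ) :
    (phiLSL δ) ^ ((4:ℝ)/3) ≤ rhoLSL δ ∧
    (phiLSL δ) ^ 4 ≤ (rhoLSL δ) ^ 3 := by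
  obtain ⟨h0, h1⟩ := hδ.phiLSL_mem_Icc
  set a : ℝ := phiLSL δ ^ ((1:ℝ) / 3) with ha
  have ha0 : 0 ≤ a := Real.rpow_nonneg h0 _
  have ha1 : a ≤ 1 := Real.rpow_le_one h0 h1 (by norm_num)
  have h3 : phiLSL δ = a ^ 3 := by
    rw [ha, ← Real.rpow_mul_natCast h0]
    norm_num
  have h4 : phiLSL δ ^ ((4:ℝ) / 3) = a ^ 4 := by
    rw [ha, ← Real.rpow_mul_natCast h0]
    norm_num
  have hρ := hδ.pow_four_le_rhoLSL ⟨ha0, ha1⟩ h3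
  refine ⟨h4.trans_le hρ, ?_⟩
  calc phiLSL δ ^ 4 = (a ^ 4) ^ 3 := by rw [h3]; ring
    _ ≤ rhoLSL δ ^ 3 := by gcongr
end

section
/- For every lower semilinear diagonal δ ∈ 𝒟^LSL, Chatterjee's rank correlation never exceeds Kendall's tau: ξ(δ) ≤ τ(δ); equivalently, ∫₀¹ (t·δ′(t) − δ(t))·(2·δ(t) − t·δ′(t))/t dt ≥ 0. -/
open MeasureTheory Set

/-- A lower semilinear diagonal is differentiable almost everywhere on `(0,1)`. -/
lemma IsLSL.ae_differentiableAt {δ : ℝ → ℝ} (hδ : IsLSL δ) :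
    ∀ᵐ t, t ∈ Ioo (0:ℝ) 1 → DifferentiableAt ℝ δ t := by
  filter_upwards [hδ.2.1.ae_differentiableWithinAt_of_mem_real] with t h ht
  exact (h (Ioo_subset_Icc_self ht)).differentiableAt (Icc_mem_nhds ht.1 ht.2)

/-- Since `δ t / t` is nondecreasing, `δ t ≤ t * δ' t` at points of differentiability. -/
lemma IsLSL.le_mul_deriv {δ : ℝ → ℝ} (hδ : IsLSL δ) {t : ℝ} (ht : t ∈ Ioo (0:ℝ) 1)
    (hd : DifferentiableAt ℝ δ t) : δ t ≤ t * deriv δ t := by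
  have h0 : 0 < t := ht.1
  have hD : HasDerivAt (fun s => δ s / s) ((deriv δ t * t - δ t * 1) / t ^ 2) t :=
    hd.hasDerivAt.div (hasDerivAt_id t) h0.ne'
  have hmono : MonotoneOn (fun s => δ s / s) (Ioo 0 1) := hδ.2.2.2.2.1.mono Ioo_subset_Ioc_self
  have hn := hmono.derivWithin_nonneg (x := t)
  rw [derivWithin_of_isOpen isOpen_Ioo ht, hD.deriv, le_div_iff₀ (by positivity)] at hn
  linarith

/-- Since `δ t / t²` is nonincreasing, `t * δ' t ≤ 2 * δ t` at points of differentiability. -/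
lemma IsLSL.mul_deriv_le {δ : ℝ → ℝ} (hδ : IsLSL δ) {t : ℝ} (ht : t ∈ Ioo (0:ℝ) 1)
    (hd : DifferentiableAt ℝ δ t) : t * deriv δ t ≤ 2 * δ t := by
  have h0 : 0 < t := ht.1
  have hD : HasDerivAt (fun s => δ s / s ^ 2)
      ((deriv δ t * t ^ 2 - δ t * (2 * t)) / (t ^ 2) ^ 2) t :=
    hd.hasDerivAt.div (by simpa using hasDerivAt_pow 2 t) (by positivity)
  have hanti : AntitoneOn (fun s => δ s / s ^ 2) (Ioo 0 1) :=
    hδ.2.2.2.2.2.mono Ioo_subset_Ioc_self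
  have hn := hanti.derivWithin_nonpos (x := t)
  rw [derivWithin_of_isOpen isOpen_Ioo ht, hD.deriv, div_le_iff₀ (by positivity)] at hn
  have hf : t * (t * deriv δ t - 2 * δ t) ≤ 0 := by linarith
  linarith [nonpos_of_mul_nonpos_right hf h0]

/-- For every lower semilinear diagonal, Chatterjee's rank correlation never exceeds
Kendall's tau; equivalently, the correction integral is nonnegative. -/
theorem xi_le_tau (δ : ℝ → ℝ) (hδ : IsLSL δ) :
    xiLSL δ ≤ tauLSL δ ∧
    0 ≤ ∫ t in (0:ℝ)..1, (t * deriv δ t - δ t) * (2 * δ t - t * deriv δ t) / t := by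
  have key : 0 ≤ ∫ t in (0:ℝ)..1,
      (t * deriv δ t - δ t) * (2 * δ t - t * deriv δ t) / t := by
    rw [intervalIntegral.integral_of_le zero_le_one, integral_Ioc_eq_integral_Ioo]
    refine setIntegral_nonneg_of_ae_restrict ?_
    filter_upwards [(ae_restrict_iff' measurableSet_Ioo).2 hδ.ae_differentiableAt,
      ae_restrict_mem measurableSet_Ioo] with t hd ht
    exact div_nonneg (mul_nonneg (sub_nonneg.2 (hδ.le_mul_deriv ht hd))
      (sub_nonneg.2 (hδ.mul_deriv_le ht hd))) ht.1.le
  refine ⟨?_, key⟩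
  unfold xiLSL
  linarith
end
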